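/- Let V : ℝ³ → ℝ be continuously differentiable with bounded, continuous gradient ∇V, and let w be a Schwartz function on ℝ³×ℝ³. For ħ > 0 define the scaled pseudo-differential operator Θ_ħ[V]w(x,v) := i (2π)^{-3/2} ∫_{ℝ³} ( (V(x + ħη/2) − V(x − ħη/2))/ħ ) (F_{v→η}w)(x,η) e^{i v·η} dη. Then Θ_ħ[V]w → ∇_x V · ∇_v w in L²(ℝ³×ℝ³) as ħ → 0⁺. -/

import Mathlib

open MeasureTheory Real Filter ENNReal RealInnerProductSpace

noncomputable section

abbrev E3 := EuclideanSpace ℝ (Fin 3)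

/-- The `i`-th standard basis vector of `ℝ³`. -/
def e3 (i : Fin 3) : E3 := EuclideanSpace.single i 1

/-- Partial Fourier transform in the velocity variable. -/
def fourierV (w : E3 × E3 → ℝ) (x η : E3) : ℂ :=
  ((2 * π : ℝ) ^ (-(3:ℝ)/2) : ℝ) *
    ∫ v : E3, (w (x, v) : ℂ) * Complex.exp (-(Complex.I) * ((⟪v, η⟫ : ℝ) : ℂ))

/-- The `ħ`-scaled pseudo-differential operator
`Θ_ħ[V]w(x,v) = i (2π)^{-3/2} ∫ ((V(x+ħη/2) − V(x−ħη/2))/ħ) (F_{v→η}w)(x,η) e^{i v·η} dη`. -/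
def ThetaH (hbar : ℝ) (V : E3 → ℝ) (w : E3 × E3 → ℝ) (p : E3 × E3) : ℂ :=
  Complex.I * ((2 * π : ℝ) ^ (-(3:ℝ)/2) : ℝ) *
    ∫ η : E3,
      (((V (p.1 + (hbar / 2) • η) - V (p.1 - (hbar / 2) • η)) / hbar : ℝ) : ℂ) *
        fourierV w p.1 η * Complex.exp (Complex.I * ((⟪p.2, η⟫ : ℝ) : ℂ))

open SchwartzMap FourierTransform LineDeriv ContDiff

/-- Plancherel's theorem for the inverse Fourier integral of a function in `L¹ ∩ L²`. -/
theorem eLpNorm_fourierInv_eq {h : E3 → ℂ} (h1 : Integrable h) (h2 : MemLp h 2) :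
    eLpNorm (𝓕⁻ h) 2 volume = eLpNorm h 2 volume := by
  set G : Lp (α := E3) ℂ 2 volume := 𝓕⁻ (h2.toLp h) with hG
  have hcont : Continuous (𝓕⁻ h) := by
    rw [fourierInv_eq_fourier_comp_neg]
    exact VectorFourier.fourierIntegral_continuous Real.continuous_fourierChar
      (by simp only [innerₗ_apply_apply]; fun_prop) h1.comp_neg
  have key : (G : E3 → ℂ) =ᵐ[volume] 𝓕⁻ h := by
    apply ae_eq_of_integral_contDiff_smul_eq (μ := volume)
    · exact (Lp.memLp G).locallyIntegrable (by norm_num)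
    · exact hcont.locallyIntegrable
    · intro g g_smooth g_cpt
      have hg₁ : HasCompactSupport (Complex.ofRealCLM ∘ g) := g_cpt.comp_left rfl
      have hg₂ : ContDiff ℝ ∞ (Complex.ofRealCLM ∘ g) := by fun_prop
      set φ : 𝓢(E3, ℂ) := hg₁.toSchwartzMap hg₂ with hφ
      have e1 : ∫ x, g x • G x = Lp.toTemperedDistribution G φ := by simp [hφ]
      have e2 : ∫ x, g x • (𝓕⁻ h) x = ∫ x, φ x • (𝓕⁻ h) x := by simp [hφ]
      rw [e1, e2, hG, ← Lp.fourierInv_toTemperedDistribution_eq,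
        TemperedDistribution.fourierInv_apply, Lp.toTemperedDistribution_apply]
      have e3 : ∫ x, (𝓕⁻ φ) x • (h2.toLp h) x = ∫ x, (𝓕⁻ φ) x • h x := by
        apply integral_congr_ae
        filter_upwards [h2.coeFn_toLp] with x hx
        rw [hx]
      rw [e3]
      rw [SchwartzMap.fourierInv_coe]
      have hL : Continuous fun p : E3 × E3 => (-innerₗ E3) p.1 p.2 := by
        simp only [LinearMap.neg_apply, innerₗ_apply_apply]; fun_prop
      have hflip := VectorFourier.integral_fourierIntegral_smul_eq_flip (μ := volume)
        (ν := volume) (L := -innerₗ E3) (f := φ) (g := h) Real.continuous_fourierChar hL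
        φ.integrable h1
      have hsymm : (-innerₗ E3).flip = -innerₗ E3 := by
        ext a b
        simp [real_inner_comm]
      rw [hsymm] at hflip
      exact hflip
  rw [← eLpNorm_congr_ae key, ← eLpNorm_congr_ae h2.coeFn_toLp,
    ← ENNReal.toReal_eq_toReal_iff' (Lp.memLp _).2.ne (Lp.memLp _).2.ne,
    ← Lp.norm_def, ← Lp.norm_def, hG]
  exact (Lp.fourierTransformₗᵢ E3 ℂ).symm.norm_map _

theorem hasTemperateGrowth_prodMk (x : E3) :
    (fun v : E3 => (x, v)).HasTemperateGrowth := by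
  have h : (fun v : E3 =>
      ((x, 0) : E3 × E3) + ContinuousLinearMap.inr ℝ E3 E3 v).HasTemperateGrowth :=
    (Function.HasTemperateGrowth.const _).add (ContinuousLinearMap.hasTemperateGrowth _)
  simpa using h

/-- The velocity slice `v ↦ w (x, v)` of a Schwartz function, as a complex Schwartz function. -/
def velocitySlice (w : SchwartzMap (E3 × E3) ℝ) (x : E3) : 𝓢(E3, ℂ) :=
  compCLMOfAntilipschitz ℝ (K := 1) (g := fun v : E3 => (x, v))
    (hasTemperateGrowth_prodMk x)
    (AntilipschitzWith.of_le_mul_dist fun a b => by simp [Prod.dist_eq])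
    (w.postcompCLM Complex.ofRealCLM)

theorem velocitySlice_apply (w : SchwartzMap (E3 × E3) ℝ) (x v : E3) :
    velocitySlice w x v = (w (x, v) : ℂ) := rfl

theorem lineDerivOp_velocitySlice (w : SchwartzMap (E3 × E3) ℝ) (x v m : E3) :
    (∂_{m} (velocitySlice w x) : 𝓢(E3, ℂ)) v = (fderiv ℝ (⇑w) (x, v) (0, m) : ℝ) := by
  rw [SchwartzMap.lineDerivOp_apply_eq_fderiv]
  have h1 : HasFDerivAt (⇑w) (fderiv ℝ (⇑w) (x, v)) (x, v) :=
    w.differentiableAt.hasFDerivAt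
  have h2 : HasFDerivAt (fun v : E3 => (x, v)) (ContinuousLinearMap.inr ℝ E3 E3) v :=
    hasFDerivAt_prodMk_right x v
  have h3 := (Complex.ofRealCLM.hasFDerivAt (x := w (x, v))).comp v (h1.comp v h2)
  have h4 : (⇑(velocitySlice w x)) = Complex.ofRealCLM ∘ (w ∘ fun v => (x, v)) := rfl
  rw [h4, h3.fderiv]
  simp

theorem measurable_fourier_velocitySlice (w : SchwartzMap (E3 × E3) ℝ) :
    Measurable fun p : E3 × E3 => 𝓕 (velocitySlice w p.1) p.2 := by
  have : StronglyMeasurable fun p : E3 × E3 =>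
      ∫ v, Complex.exp (↑(-2 * π * ⟪v, p.2⟫) * Complex.I) • (w (p.1, v) : ℂ) := by
    apply StronglyMeasurable.integral_prod_right'
      (f := fun q : (E3 × E3) × E3 =>
        Complex.exp (↑(-2 * π * ⟪q.2, q.1.2⟫) * Complex.I) • (w (q.1.1, q.2) : ℂ))
    apply Continuous.stronglyMeasurable
    have := w.continuous
    fun_prop
  convert this.measurable using 2 with p
  rw [SchwartzMap.fourier_coe, Real.fourier_eq']
  rfl

theorem fourier_lineDerivOp_apply (f : 𝓢(E3, ℂ)) (m ξ : E3) :
    𝓕 (∂_{m} f : 𝓢(E3, ℂ)) ξ = Complex.I * (((2 * π * ⟪ξ, m⟫ : ℝ) : ℂ) * 𝓕 f ξ) := by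
  have : (inner ℝ · m : E3 → ℝ).HasTemperateGrowth := by fun_prop
  rw [fourier_lineDerivOp_eq]
  simp [this]
  ring

theorem fderiv_eq_fourierInv (w : SchwartzMap (E3 × E3) ℝ) (x v m : E3) :
    ((fderiv ℝ (⇑w) (x, v) (0, m) : ℝ) : ℂ) =
      Complex.I * 𝓕⁻ (fun ξ : E3 => ((2 * π * ⟪ξ, m⟫ : ℝ) : ℂ) * 𝓕 (velocitySlice w x) ξ) v := by
  rw [← lineDerivOp_velocitySlice,
    ← FourierTransform.fourierInv_fourier_eq (F := 𝓢(E3, ℂ)) (∂_{m} (velocitySlice w x) : 𝓢(E3, ℂ)),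
    SchwartzMap.fourierInv_coe, Real.fourierInv_eq', Real.fourierInv_eq', ← integral_const_mul]
  congr 1 with ξ
  rw [fourier_lineDerivOp_apply]
  simp only [smul_eq_mul]
  ring

theorem fourierV_smul (w : SchwartzMap (E3 × E3) ℝ) (x ξ : E3) :
    fourierV w x ((2 * π) • ξ) =
      ((2 * π : ℝ) ^ (-(3:ℝ)/2) : ℝ) * 𝓕 (velocitySlice w x) ξ := by
  rw [fourierV, SchwartzMap.fourier_coe, Real.fourier_eq']
  congr 2 with v
  rw [velocitySlice_apply, smul_eq_mul, mul_comm, inner_smul_right]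
  congr 2
  push_cast
  ring

theorem ThetaH_eq_fourierInv (hbar : ℝ) (V : E3 → ℝ) (w : SchwartzMap (E3 × E3) ℝ) (x v : E3) :
    ThetaH hbar V w (x, v) = Complex.I * 𝓕⁻ (fun ξ : E3 =>
      (((V (x + (hbar * π) • ξ) - V (x - (hbar * π) • ξ)) / hbar : ℝ) : ℂ) *
        𝓕 (velocitySlice w x) ξ) v := by
  have hc : (2 * π : ℝ) ^ (-(3:ℝ)/2) * (2 * π : ℝ) ^ (-(3:ℝ)/2) * (2 * π) ^ 3 = 1 := by
    rw [← Real.rpow_add (by positivity), ← Real.rpow_natCast, ← Real.rpow_add (by positivity)]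
    norm_num
  have hs := Measure.integral_comp_smul (volume : Measure E3) (fun η : E3 =>
      (((V (x + (hbar / 2) • η) - V (x - (hbar / 2) • η)) / hbar : ℝ) : ℂ) *
        fourierV w x η * Complex.exp (Complex.I * ((⟪v, η⟫ : ℝ) : ℂ))) (2 * π)
  have hpos : (0:ℝ) < (2 * π) ^ 3 := by positivity
  rw [finrank_euclideanSpace_fin, abs_of_pos (inv_pos.2 hpos), eq_inv_smul_iff₀ hpos.ne'] at hs
  rw [ThetaH, ← hs, Real.fourierInv_eq', mul_assoc]
  congr 1
  rw [Complex.real_smul, ← integral_const_mul, ← integral_const_mul]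
  congr 1 with ξ
  rw [fourierV_smul]
  have e1 : (hbar / 2) • (2 * π) • ξ = (hbar * π) • ξ := by
    rw [smul_smul]; congr 1; ring
  have e2 : Complex.I * ((⟪v, (2 * π) • ξ⟫ : ℝ) : ℂ) = (↑(2 * π * ⟪ξ, v⟫) * Complex.I : ℂ) := by
    rw [inner_smul_right, real_inner_comm, mul_comm]
  have hc' := congrArg (fun r : ℝ => (r : ℂ)) hc
  simp only [Complex.ofReal_mul, Complex.ofReal_one] at hc'
  rw [e1, e2, smul_eq_mul]
  simp only [Complex.ofReal_mul] at *
  linear_combination (Complex.exp (2 * π * ⟪ξ, v⟫ * Complex.I) *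
    (((V (x + (hbar * π) • ξ) - V (x - (hbar * π) • ξ)) / hbar : ℝ) : ℂ) *
    𝓕 (velocitySlice w x) ξ) * hc'

theorem eLpNorm_two_eq_lintegral_rpow {α : Type*} [MeasurableSpace α] {μ : Measure α}
    (f : α → ℂ) : eLpNorm f 2 μ = (∫⁻ a, ‖f a‖ₑ ^ 2 ∂μ) ^ (1 / 2 : ℝ) := by
  rw [eLpNorm_eq_lintegral_rpow_enorm_toReal (by norm_num) (by norm_num)]
  simp

theorem lintegral_enorm_sq_le_of_eLpNorm_le {α : Type*} [MeasurableSpace α] {μ : Measure α}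
    {f g : α → ℂ} (h : eLpNorm f 2 μ ≤ eLpNorm g 2 μ) :
    ∫⁻ a, ‖f a‖ₑ ^ 2 ∂μ ≤ ∫⁻ a, ‖g a‖ₑ ^ 2 ∂μ := by
  rw [eLpNorm_two_eq_lintegral_rpow, eLpNorm_two_eq_lintegral_rpow] at h
  exact (ENNReal.rpow_le_rpow_iff (by norm_num)).1 h

theorem lintegral_enorm_sq_fourierInv_le {h : E3 → ℂ} (h1 : Integrable h) :
    ∫⁻ v, ‖𝓕⁻ h v‖ₑ ^ 2 ≤ ∫⁻ ξ, ‖h ξ‖ₑ ^ 2 := by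
  apply lintegral_enorm_sq_le_of_eLpNorm_le
  by_cases h2 : eLpNorm h 2 volume = ⊤
  · rw [h2]; exact le_top
  · exact (eLpNorm_fourierInv_eq h1 ⟨h1.1, lt_top_iff_ne_top.2 h2⟩).le

theorem lintegral_enorm_sq_fourier_le (f : 𝓢(E3, ℂ)) :
    ∫⁻ ξ, ‖𝓕 f ξ‖ₑ ^ 2 ≤ ∫⁻ v, ‖f v‖ₑ ^ 2 := by
  apply lintegral_enorm_sq_le_of_eLpNorm_le
  have h := norm_fourier_toL2_eq f
  rw [norm_toLp, norm_toLp] at h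
  have h1 : eLpNorm (𝓕 f : 𝓢(E3, ℂ)) 2 volume ≠ ⊤ := ((𝓕 f : 𝓢(E3, ℂ)).memLp 2 volume).2.ne
  have h2 : eLpNorm f 2 volume ≠ ⊤ := (f.memLp 2 volume).2.ne
  exact ((ENNReal.toReal_eq_toReal_iff' h1 h2).1 h).le

theorem enorm_sq_eq_sum (ξ : E3) : ‖ξ‖ₑ ^ 2 = ∑ i, ‖ξ i‖ₑ ^ 2 := by
  simp_rw [← ofReal_norm, ← ENNReal.ofReal_pow (norm_nonneg _)]
  rw [← ENNReal.ofReal_sum_of_nonneg (fun _ _ => by positivity), EuclideanSpace.norm_sq_eq]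

theorem lintegral_enorm_sq_mul_fourier_le (f : 𝓢(E3, ℂ)) :
    ∫⁻ ξ, ‖ξ‖ₑ ^ 2 * ‖𝓕 f ξ‖ₑ ^ 2 ≤
      ∑ i, ∫⁻ v, ‖(∂_{e3 i} f : 𝓢(E3, ℂ)) v‖ₑ ^ 2 := by
  calc ∫⁻ ξ, ‖ξ‖ₑ ^ 2 * ‖𝓕 f ξ‖ₑ ^ 2
      ≤ ∫⁻ ξ, ∑ i, ‖𝓕 (∂_{e3 i} f : 𝓢(E3, ℂ)) ξ‖ₑ ^ 2 := by
        apply lintegral_mono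
        intro ξ
        simp only [enorm_sq_eq_sum, Finset.sum_mul]
        refine Finset.sum_le_sum fun i _ => ?_
        rw [fourier_lineDerivOp_apply, ← mul_pow, ← enorm_norm, ← enorm_norm (𝓕 f ξ),
          ← enorm_mul, ← enorm_norm (Complex.I * _)]
        gcongr
        rw [Real.enorm_eq_ofReal (by positivity), Real.enorm_eq_ofReal (by positivity)]
        apply ENNReal.ofReal_le_ofReal
        have h : (1:ℝ) ≤ 2 * π := by linarith [Real.pi_gt_three]
        simp only [norm_mul, Complex.norm_I, one_mul, Complex.norm_real, e3,
          EuclideanSpace.inner_single_right, Real.norm_eq_abs, RCLike.conj_to_real]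
        rw [← abs_mul 2 π, abs_of_pos (by positivity : 0 < 2 * π)]
        gcongr
        exact le_mul_of_one_le_left (abs_nonneg _) h
    _ = ∑ i, ∫⁻ ξ, ‖𝓕 (∂_{e3 i} f : 𝓢(E3, ℂ)) ξ‖ₑ ^ 2 := by
        apply lintegral_finsetSum
        intro i _
        have := (𝓕 (∂_{e3 i} f : 𝓢(E3, ℂ))).continuous.measurable
        fun_prop
    _ ≤ _ := Finset.sum_le_sum fun i _ => lintegral_enorm_sq_fourier_le _

theorem lintegral_enorm_sq_mul_fourier_velocitySlice_ne_top (w : SchwartzMap (E3 × E3) ℝ) :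
    ∫⁻ p : E3 × E3, ‖p.2‖ₑ ^ 2 * ‖𝓕 (velocitySlice w p.1) p.2‖ₑ ^ 2 ≠ ⊤ := by
  refine ne_top_of_le_ne_top ?_ (lintegral_prod_le _)
  have h i : Measurable fun p : E3 × E3 =>
      ‖(∂_{((0, e3 i) : E3 × E3)} w : 𝓢(E3 × E3, ℝ)) p‖ₑ ^ 2 := by
    have := (∂_{((0, e3 i) : E3 × E3)} w : 𝓢(E3 × E3, ℝ)).continuous.measurable
    fun_prop
  have hle (x : E3) : ∫⁻ ξ, ‖ξ‖ₑ ^ 2 * ‖𝓕 (velocitySlice w x) ξ‖ₑ ^ 2 ≤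
      ∑ i, ∫⁻ v, ‖(∂_{((0, e3 i) : E3 × E3)} w : 𝓢(E3 × E3, ℝ)) (x, v)‖ₑ ^ 2 := by
    refine (lintegral_enorm_sq_mul_fourier_le _).trans_eq ?_
    congr! 4 with i _ v
    rw [lineDerivOp_velocitySlice, SchwartzMap.lineDerivOp_apply_eq_fderiv, ← enorm_norm,
      Complex.norm_real, enorm_norm]
  refine ne_top_of_le_ne_top ?_ (lintegral_mono hle)
  rw [lintegral_finsetSum _ fun i _ => (h i).lintegral_prod_right', ENNReal.sum_ne_top]
  intro i _
  rw [← lintegral_prod _ (h i).aemeasurable]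
  have hprod : ((volume : Measure E3).prod (volume : Measure E3)).IsAddHaarMeasure := inferInstance
  have : ((volume : Measure E3).prod (volume : Measure E3)).HasTemperateGrowth :=
    MeasureTheory.Measure.IsAddHaarMeasure.instHasTemperateGrowth (h := hprod)
  have h2 := ((∂_{((0, e3 i) : E3 × E3)} w : 𝓢(E3 × E3, ℝ)).memLp 2
    ((volume : Measure E3).prod volume)).2
  rw [eLpNorm_lt_top_iff_lintegral_rpow_enorm_lt_top (by norm_num) (by norm_num)] at h2
  simpa using h2.ne

/-- The difference between the symbol of `Θ_ħ[V]` and that of `∇V · ∇_v`, both divided by `i`. -/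
def symbolError (V : E3 → ℝ) (hbar : ℝ) (x ξ : E3) : ℝ :=
  (V (x + (hbar * π) • ξ) - V (x - (hbar * π) • ξ)) / hbar - 2 * π * ⟪ξ, gradient V x⟫

theorem abs_symmetric_difference_quotient_le {V : E3 → ℝ} (hV : Differentiable ℝ V) {M : ℝ}
    (hM : ∀ x, ‖gradient V x‖ ≤ M) (hbar : ℝ) (x ξ : E3) :
    |(V (x + (hbar * π) • ξ) - V (x - (hbar * π) • ξ)) / hbar| ≤ 2 * π * M * ‖ξ‖ := by
  have hM0 : 0 ≤ M := (norm_nonneg _).trans (hM 0)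
  rcases eq_or_ne hbar 0 with rfl | hne
  · simp; positivity
  have h := Convex.norm_image_sub_le_of_norm_fderiv_le (𝕜 := ℝ) (f := V) (C := M) (s := Set.univ)
    (x := x - (hbar * π) • ξ) (y := x + (hbar * π) • ξ) (fun x _ => hV x)
    (fun x _ => by rw [← toDual_gradient, LinearIsometryEquiv.norm_map]; exact hM x)
    convex_univ trivial trivial
  have e : x + (hbar * π) • ξ - (x - (hbar * π) • ξ) = (2 * hbar * π) • ξ := by module
  rw [e, norm_smul, Real.norm_eq_abs, Real.norm_eq_abs, abs_mul, abs_mul, abs_two,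
    abs_of_pos Real.pi_pos] at h
  rw [abs_div, div_le_iff₀ (abs_pos.2 hne)]
  linarith

theorem abs_inner_gradient_le {V : E3 → ℝ} {M : ℝ}
    (hM : ∀ x, ‖gradient V x‖ ≤ M) (x ξ : E3) :
    |2 * π * ⟪ξ, gradient V x⟫| ≤ 2 * π * M * ‖ξ‖ := by
  rw [abs_mul, abs_of_pos (by positivity : 0 < 2 * π), mul_assoc (2 * π), mul_comm M]
  gcongr
  exact (abs_real_inner_le_norm _ _).trans (by gcongr; exact hM x)

theorem abs_symbolError_le {V : E3 → ℝ} (hV : Differentiable ℝ V) {M : ℝ}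
    (hM : ∀ x, ‖gradient V x‖ ≤ M) (hbar : ℝ) (x ξ : E3) :
    |symbolError V hbar x ξ| ≤ 4 * π * M * ‖ξ‖ := by
  refine (abs_sub _ _).trans ?_
  linarith [abs_symmetric_difference_quotient_le hV hM hbar x ξ, abs_inner_gradient_le hM x ξ]

theorem tendsto_symbolError {V : E3 → ℝ} (hV : Differentiable ℝ V) (x ξ : E3) :
    Tendsto (fun hbar => symbolError V hbar x ξ) (nhdsWithin 0 (Set.Ioi 0)) (nhds 0) := by
  have hline (c : ℝ) : HasDerivAt (fun t : ℝ => V (x + (t * c) • ξ)) (c * ⟪ξ, gradient V x⟫) 0 := by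
    have h1 : HasDerivAt (fun t : ℝ => x + (t * c) • ξ) (c • ξ) 0 := by
      simpa using (((hasDerivAt_id (0:ℝ)).mul_const c).smul_const ξ).const_add x
    have h2 : HasFDerivAt V (fderiv ℝ V x) (x + ((0:ℝ) * c) • ξ) := by
      simpa using (hV x).hasFDerivAt
    have h3 := h2.comp_hasDerivAt (0:ℝ) h1
    rw [inner_gradient_right]
    simpa [Function.comp_def] using h3
  have h := ((hline π).sub (hline (-π))).tendsto_slope_zero_right
  have h' := h.sub_const (2 * π * ⟪ξ, gradient V x⟫)
  have e0 : π * ⟪ξ, gradient V x⟫ - -π * ⟪ξ, gradient V x⟫ - 2 * π * ⟪ξ, gradient V x⟫ = 0 := by ring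
  rw [e0] at h'
  refine h'.congr fun t => ?_
  simp only [symbolError, Pi.sub_apply, zero_add, zero_mul, zero_smul, add_zero, sub_self, sub_zero,
    smul_eq_mul, mul_neg, neg_smul, ← sub_eq_add_neg]
  rw [inv_mul_eq_div]

theorem integrable_mul_fourier {a : E3 → ℝ} (ha : Measurable a) {C : ℝ}
    (hC : ∀ ξ, |a ξ| ≤ C * ‖ξ‖) (f : 𝓢(E3, ℂ)) :
    Integrable fun ξ => (a ξ : ℂ) * 𝓕 f ξ := by
  refine (((𝓕 f).integrable_pow_mul volume 1).const_mul C).mono' ?_ (ae_of_all _ fun ξ => ?_)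
  · have := (𝓕 f).continuous.measurable
    exact Measurable.aestronglyMeasurable (by fun_prop)
  · rw [norm_mul, Complex.norm_real, Real.norm_eq_abs, pow_one, ← mul_assoc]
    gcongr
    exact hC ξ

theorem ThetaH_sub_eq_fourierInv {V : E3 → ℝ} (hV : Differentiable ℝ V) {M : ℝ}
    (hM : ∀ x, ‖gradient V x‖ ≤ M) (w : SchwartzMap (E3 × E3) ℝ) (hbar : ℝ) (x v : E3) :
    ThetaH hbar V w (x, v) -
        ((∑ i : Fin 3, gradient V x i * fderiv ℝ (⇑w) (x, v) (0, e3 i) : ℝ) : ℂ) =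
      Complex.I *
        𝓕⁻ (fun ξ => (symbolError V hbar x ξ : ℂ) * 𝓕 (velocitySlice w x) ξ) v := by
  have hsum : ∑ i : Fin 3, gradient V x i * fderiv ℝ (⇑w) (x, v) (0, e3 i) =
      fderiv ℝ (⇑w) (x, v) (0, gradient V x) := by
    have h : gradient V x = ∑ i, gradient V x i • e3 i := by
      have := (EuclideanSpace.basisFun (Fin 3) ℝ).sum_repr (gradient V x)
      simpa [e3] using this.symm
    have h' : ((0, gradient V x) : E3 × E3) = ContinuousLinearMap.inr ℝ E3 E3 (gradient V x) := rfl
    rw [h']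
    conv_rhs => rw [h]
    simp only [map_sum, map_smul, smul_eq_mul, ContinuousLinearMap.inr_apply]
  have hVc := hV.continuous
  have i1 := integrable_mul_fourier (a := fun ξ =>
      (V (x + (hbar * π) • ξ) - V (x - (hbar * π) • ξ)) / hbar)
    (Continuous.measurable (by fun_prop))
    (abs_symmetric_difference_quotient_le hV hM hbar x) (velocitySlice w x)
  have i2 := integrable_mul_fourier (a := fun ξ => 2 * π * ⟪ξ, gradient V x⟫)
    (Continuous.measurable (by fun_prop)) (abs_inner_gradient_le hM x) (velocitySlice w x)
  rw [hsum, ThetaH_eq_fourierInv, fderiv_eq_fourierInv, ← mul_sub]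
  congr 1
  rw [Real.fourierInv_eq, Real.fourierInv_eq, Real.fourierInv_eq, ← integral_sub]
  · congr 1 with ξ
    rw [← smul_sub, ← sub_mul, symbolError, Complex.ofReal_sub]
  · simpa [real_inner_comm] using (Real.fourierIntegral_convergent_iff (-v)).2 i1
  · simpa [real_inner_comm] using (Real.fourierIntegral_convergent_iff (-v)).2 i2

/-- Remark 4.5 (semiclassical limit): `Θ_ħ[V]w → ∇_x V · ∇_v w` in `L²(ℝ⁶)` as `ħ → 0⁺`. -/
theorem semiclassical_limit (V : E3 → ℝ) (hV : ContDiff ℝ 1 V)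
    (hcont : Continuous fun x => gradient V x)
    (hbd : BddAbove (Set.range fun x => ‖gradient V x‖))
    (w : SchwartzMap (E3 × E3) ℝ) :
    Tendsto
      (fun hbar : ℝ =>
        eLpNorm
          (fun p : E3 × E3 =>
            ThetaH hbar V (⇑w) p -
              ((∑ i : Fin 3, gradient V p.1 i * fderiv ℝ (⇑w) p (0, e3 i) : ℝ) : ℂ))
          2 volume)
      (nhdsWithin 0 (Set.Ioi 0)) (nhds 0) := by
  have hVd : Differentiable ℝ V := hV.differentiable (by norm_num)
  obtain ⟨M, hM'⟩ := hbd
  have hM : ∀ x, ‖gradient V x‖ ≤ M := fun x => hM' (Set.mem_range_self x)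
  set g : ℝ → E3 × E3 → ℂ := fun hbar p =>
    (symbolError V hbar p.1 p.2 : ℂ) * 𝓕 (velocitySlice w p.1) p.2 with hg
  have hfm := measurable_fourier_velocitySlice w
  have hsm (hbar : ℝ) : Measurable fun p : E3 × E3 => symbolError V hbar p.1 p.2 := by
    have := hV.continuous
    unfold symbolError
    exact Continuous.measurable (by fun_prop)
  have hgm (hbar : ℝ) : Measurable (g hbar) := by
    have := hsm hbar
    fun_prop
  have hle (hbar : ℝ) : eLpNorm (fun p : E3 × E3 => ThetaH hbar V (⇑w) p -
      ((∑ i : Fin 3, gradient V p.1 i * fderiv ℝ (⇑w) p (0, e3 i) : ℝ) : ℂ)) 2 volume ≤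
      (∫⁻ p, ‖g hbar p‖ₑ ^ 2) ^ (1 / 2 : ℝ) := by
    rw [eLpNorm_two_eq_lintegral_rpow]
    refine ENNReal.rpow_le_rpow ((lintegral_prod_le _).trans ?_) (by norm_num)
    rw [Measure.volume_eq_prod, lintegral_prod _ ((hgm hbar).enorm.pow_const 2).aemeasurable]
    refine lintegral_mono fun x => ?_
    have hi : Integrable fun ξ => g hbar (x, ξ) :=
      integrable_mul_fourier ((hsm hbar).comp measurable_prodMk_left)
        (abs_symbolError_le hVd hM hbar x) (velocitySlice w x)
    refine le_trans (le_of_eq ?_) (lintegral_enorm_sq_fourierInv_le hi)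
    congr 1 with v
    rw [ThetaH_sub_eq_fourierInv hVd hM, enorm_mul, ← enorm_norm Complex.I, Complex.norm_I,
      enorm_one, one_mul]
  have hlim : Tendsto (fun hbar => ∫⁻ p, ‖g hbar p‖ₑ ^ 2) (nhdsWithin 0 (Set.Ioi 0)) (nhds 0) := by
    rw [← lintegral_zero (α := E3 × E3) (μ := volume)]
    apply tendsto_lintegral_filter_of_dominated_convergence
      (fun p => ‖4 * π * M‖ₑ ^ 2 * (‖p.2‖ₑ ^ 2 * ‖𝓕 (velocitySlice w p.1) p.2‖ₑ ^ 2))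
    · exact Eventually.of_forall fun hbar => (hgm hbar).enorm.pow_const 2
    · refine Eventually.of_forall fun hbar => ae_of_all _ fun p => ?_
      simp only [hg]
      rw [enorm_mul, mul_pow, ← mul_assoc, ← mul_pow (‖4 * π * M‖ₑ)]
      gcongr
      rw [← enorm_norm, ← enorm_norm p.2, ← enorm_mul, Complex.norm_real, Real.norm_eq_abs,
        enorm_le_iff_norm_le]
      simp only [norm_abs_eq_norm, Real.norm_eq_abs]
      exact (abs_symbolError_le hVd hM hbar p.1 p.2).trans (le_abs_self _)
    · rw [lintegral_const_mul' _ _ (by finiteness)]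
      exact ENNReal.mul_ne_top (by finiteness)
        (lintegral_enorm_sq_mul_fourier_velocitySlice_ne_top w)
    · refine ae_of_all _ fun p => ?_
      have h1 : Tendsto (fun hbar => g hbar p) (nhdsWithin 0 (Set.Ioi 0)) (nhds 0) := by
        simpa using ((Complex.continuous_ofReal.tendsto 0).comp
          (tendsto_symbolError hVd p.1 p.2)).mul_const (𝓕 (velocitySlice w p.1) p.2)
      simpa [Function.comp_def] using
        ((ENNReal.continuous_pow 2).comp continuous_enorm).tendsto 0 |>.comp h1
  have hlim' := (ENNReal.continuous_rpow_const (y := 1 / 2)).tendsto 0 |>.comp hlim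
  simp only [ENNReal.zero_rpow_of_pos (by norm_num : (0:ℝ) < 1 / 2)] at hlim'
  exact tendsto_of_tendsto_of_tendsto_of_le_of_le tendsto_const_nhds hlim'
    (fun _ => zero_le) hle

end
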